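/- Let (S,d) be a Polish metric space and μ₁, μ₂ probability measures on S with finite first moment. Then the L¹-Wasserstein distance W(μ₁,μ₂) = inf over couplings Π of ∫ d(x,y) dΠ equals the supremum over 1-Lipschitz functions f : S → ℝ of |∫f dμ₁ − ∫f dμ₂|. -/

import Mathlib

open MeasureTheory ProbabilityTheory

/-- The L¹-Wasserstein distance: infimum over couplings of the expected distance. -/
noncomputable def wassDist {S : Type*} [MeasurableSpace S] [PseudoMetricSpace S]
    (μ ν : Measure S) : ℝ :=
  sInf { r : ℝ | ∃ Λ : Measure (S × S), IsProbabilityMeasure Λ ∧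
    Λ.map Prod.fst = μ ∧ Λ.map Prod.snd = ν ∧ r = ∫ p, dist p.1 p.2 ∂Λ }

/-- **Finite Kantorovich duality.** If every pair of dual-feasible potentials has value at most
`C`, then some transport plan between the finite distributions `p` and `q` has cost at
most `C`. -/
theorem exists_plan_cost_le_of_dual_le {ι κ : Type*} [Fintype ι] [Fintype κ]
    {p : ι → ℝ} {q : κ → ℝ} (hp : p ∈ stdSimplex ℝ ι) (hq : q ∈ stdSimplex ℝ κ)
    (c : ι → κ → ℝ) (C : ℝ)
    (h : ∀ (φ : ι → ℝ) (ψ : κ → ℝ), (∀ i j, φ i + ψ j ≤ c i j) →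
      ∑ i, p i * φ i + ∑ j, q j * ψ j ≤ C) :
    ∃ π : ι → κ → ℝ, (∀ i j, 0 ≤ π i j) ∧ (∀ i, ∑ j, π i j = p i) ∧ (∀ j, ∑ i, π i j = q j) ∧
      ∑ i, ∑ j, π i j * c i j ≤ C := by
  classical
  let L : (ι × κ → ℝ) →ₗ[ℝ] (ι → ℝ) × (κ → ℝ) × ℝ :=
    { toFun := fun π => (fun i => ∑ j, π (i, j), fun j => ∑ i, π (i, j),
        ∑ i, ∑ j, π (i, j) * c i j)
      map_add' := fun π ρ => by
        ext <;> simp [Finset.sum_add_distrib, add_mul]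
      map_smul' := fun r π => by
        ext <;> simp [Finset.mul_sum, mul_assoc] }
  let T : Set ((ι → ℝ) × (κ → ℝ) × ℝ) := {p} ×ˢ {q} ×ˢ Set.Iic C
  by_contra hcon
  have hdisj : Disjoint (L '' stdSimplex ℝ (ι × κ)) T := by
    rw [Set.disjoint_left]
    rintro _ ⟨π, hπ, rfl⟩ hT
    obtain ⟨hT1, hT2, hT3⟩ := hT
    exact hcon ⟨fun i j => π (i, j), fun i j => hπ.1 _, fun i => congrFun hT1 i,
      fun j => congrFun hT2 j, hT3⟩
  obtain ⟨f, u, v, hfu, huv, hfv⟩ := geometric_hahn_banach_compact_closed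
    ((convex_stdSimplex ℝ (ι × κ)).linear_image L)
    ((isCompact_stdSimplex ℝ (ι × κ)).image L.continuous_of_finiteDimensional)
    ((convex_singleton p).prod ((convex_singleton q).prod (convex_Iic C)))
    (isClosed_singleton.prod (isClosed_singleton.prod isClosed_Iic)) hdisj
  let a : ι → ℝ := fun i => f (Pi.single i 1, 0, 0)
  let b : κ → ℝ := fun j => f (0, Pi.single j 1, 0)
  let s : ℝ := f (0, 0, 1)
  have hf : ∀ x y t, f (x, y, t) = ∑ i, x i * a i + ∑ j, y j * b j + t * s := by
    intro x y t
    have hdec : (x, y, t) = ∑ i, x i • ((Pi.single i 1, 0, 0) : (ι → ℝ) × (κ → ℝ) × ℝ)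
        + ∑ j, y j • ((0, Pi.single j 1, 0) : (ι → ℝ) × (κ → ℝ) × ℝ)
        + t • ((0, 0, 1) : (ι → ℝ) × (κ → ℝ) × ℝ) := by
      ext k <;>
        simp [Prod.fst_sum, Prod.snd_sum, Finset.sum_apply, Pi.single_apply]
    rw [hdec, map_add, map_add, map_sum, map_sum]
    simp only [map_smul, smul_eq_mul, a, b, s]
  have hab : ∀ i j, a i + b j + c i j * s < u := by
    intro i j
    have := hfu _ ⟨_, single_mem_stdSimplex ℝ (i, j), rfl⟩
    have hL : L (Pi.single (i, j) 1) = (Pi.single i 1, Pi.single j 1, c i j) := by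
      ext k
      · by_cases hk : k = i <;> simp [L, Pi.single_apply, hk, -Finset.sum_boole]
      · by_cases hk : k = j <;> simp [L, Pi.single_apply, hk, -Finset.sum_boole]
      · change ∑ i', ∑ j', (Pi.single (i, j) 1 : ι × κ → ℝ) (i', j') * c i' j' = c i j
        rw [Finset.sum_eq_single i, Finset.sum_eq_single j] <;>
          simp +contextual [Pi.single_apply]
    rw [hL, hf] at this
    simpa [Pi.single_apply] using this
  have hpq : ∀ t ≤ C, v < ∑ i, p i * a i + ∑ j, q j * b j + t * s := by
    intro t ht
    rw [← hf]
    exact hfv _ ⟨rfl, rfl, ht⟩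
  have hs : s ≤ 0 := by
    by_contra! hs
    have h1 := hpq (min C ((v - ∑ i, p i * a i - ∑ j, q j * b j) / s)) (min_le_left _ _)
    have h2 := mul_le_mul_of_nonneg_right
      (min_le_right C ((v - ∑ i, p i * a i - ∑ j, q j * b j) / s)) hs.le
    rw [div_mul_cancel₀ _ hs.ne'] at h2
    linarith
  have hsum : ∀ (φ : ι → ℝ) (ψ : κ → ℝ) (w : ℝ), (∀ i j, φ i + ψ j ≤ w) →
      ∑ i, p i * φ i + ∑ j, q j * ψ j ≤ w := by
    intro φ ψ w hw
    have h1 : ∀ i, φ i + ∑ j, q j * ψ j ≤ w := fun i => by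
      calc φ i + ∑ j, q j * ψ j = ∑ j, q j * (φ i + ψ j) := by
            simp_rw [mul_add, Finset.sum_add_distrib, ← Finset.sum_mul, hq.2, one_mul]
        _ ≤ ∑ j, q j * w := Finset.sum_le_sum fun j _ => mul_le_mul_of_nonneg_left (hw i j) (hq.1 j)
        _ = w := by rw [← Finset.sum_mul, hq.2, one_mul]
    calc ∑ i, p i * φ i + ∑ j, q j * ψ j = ∑ i, p i * (φ i + ∑ j, q j * ψ j) := by
          simp_rw [mul_add, Finset.sum_add_distrib, ← Finset.sum_mul, hp.2, one_mul]
      _ ≤ ∑ i, p i * w := Finset.sum_le_sum fun i _ => mul_le_mul_of_nonneg_left (h1 i) (hp.1 i)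
      _ = w := by rw [← Finset.sum_mul, hp.2, one_mul]
  have hpqC := hpq C le_rfl
  rcases hs.eq_or_lt with hs | hs
  · have := hsum a b u fun i j => by simpa [hs] using (hab i j).le
    rw [hs] at hpqC
    linarith
  · have hr : 0 < -s := neg_pos.2 hs
    have key := h (fun i => (a i - u) / -s) (fun j => b j / -s) fun i j => by
      rw [← add_div, div_le_iff₀ hr]
      linarith [hab i j]
    simp_rw [← mul_div_assoc, ← Finset.sum_div, mul_sub, Finset.sum_sub_distrib,
      ← Finset.sum_mul, hp.2] at key
    rw [← add_div, div_le_iff₀ hr] at key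
    linarith

/-- Couplings of the discretizations of two measures lift to couplings of the measures. -/
theorem exists_coupling_of_plan {X Y ι κ : Type*} [MeasurableSpace X] [MeasurableSpace Y]
    [Fintype ι] [Fintype κ] [MeasurableSpace ι] [MeasurableSpace κ]
    [MeasurableSingletonClass ι] [MeasurableSingletonClass κ]
    (μ : Measure X) (ν : Measure Y) [IsProbabilityMeasure μ] [IsProbabilityMeasure ν]
    {F : X → ι} {G : Y → κ} (hF : Measurable F) (hG : Measurable G)
    (π : ι → κ → ℝ) (hπ : ∀ i j, 0 ≤ π i j) (hπ₁ : ∀ i, ∑ j, π i j = μ.real (F ⁻¹' {i}))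
    (hπ₂ : ∀ j, ∑ i, π i j = ν.real (G ⁻¹' {j})) :
    ∃ Λ : Measure (X × Y), IsProbabilityMeasure Λ ∧ Λ.map Prod.fst = μ ∧ Λ.map Prod.snd = ν ∧
      ∀ c : ι → κ → ℝ, ∫ z, c (F z.1) (G z.2) ∂Λ = ∑ i, ∑ j, π i j * c i j := by
  have hFi : ∀ i, MeasurableSet (F ⁻¹' {i}) := fun i => hF (measurableSet_singleton i)
  have hGj : ∀ j, MeasurableSet (G ⁻¹' {j}) := fun j => hG (measurableSet_singleton j)
  have hμ : ∀ i j, π i j ≠ 0 → IsProbabilityMeasure μ[|F ⁻¹' {i}] := fun i j hij => by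
    refine cond_isProbabilityMeasure fun h0 => hij ?_
    have h1 := hπ₁ i
    rw [measureReal_def, h0, ENNReal.toReal_zero,
      Finset.sum_eq_zero_iff_of_nonneg fun j _ => hπ i j] at h1
    exact h1 j (Finset.mem_univ j)
  have hν : ∀ i j, π i j ≠ 0 → IsProbabilityMeasure ν[|G ⁻¹' {j}] := fun i j hij => by
    refine cond_isProbabilityMeasure fun h0 => hij ?_
    have h1 := hπ₂ j
    rw [measureReal_def, h0, ENNReal.toReal_zero,
      Finset.sum_eq_zero_iff_of_nonneg fun i _ => hπ i j] at h1
    exact h1 i (Finset.mem_univ i)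
  have hrow : ∀ i, ∑ j, ENNReal.ofReal (π i j) = μ (F ⁻¹' {i}) := fun i => by
    rw [← ENNReal.ofReal_sum_of_nonneg fun j _ => hπ i j, hπ₁, ofReal_measureReal]
  have hcol : ∀ j, ∑ i, ENNReal.ofReal (π i j) = ν (G ⁻¹' {j}) := fun j => by
    rw [← ENNReal.ofReal_sum_of_nonneg fun i _ => hπ i j, hπ₂, ofReal_measureReal]
  let Λ : Measure (X × Y) :=
    ∑ i, ∑ j, ENNReal.ofReal (π i j) • (μ[|F ⁻¹' {i}]).prod (ν[|G ⁻¹' {j}])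
  have h1 : Λ.map Prod.fst = μ := by
    have : ∀ i j, (ENNReal.ofReal (π i j) • (μ[|F ⁻¹' {i}]).prod (ν[|G ⁻¹' {j}])).map Prod.fst
        = ENNReal.ofReal (π i j) • μ[|F ⁻¹' {i}] := fun i j => by
      by_cases hij : π i j = 0
      · simp [hij]
      · have := hν i j hij
        rw [Measure.map_smul, Measure.map_fst_prod, measure_univ, one_smul]
    simp_rw [Λ, Measure.map_finset_sum' measurable_fst.aemeasurable, this, ← Finset.sum_smul,
      hrow]
    exact sum_meas_smul_cond_fiber hF μ
  have h2 : Λ.map Prod.snd = ν := by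
    have : ∀ i j, (ENNReal.ofReal (π i j) • (μ[|F ⁻¹' {i}]).prod (ν[|G ⁻¹' {j}])).map Prod.snd
        = ENNReal.ofReal (π i j) • ν[|G ⁻¹' {j}] := fun i j => by
      by_cases hij : π i j = 0
      · simp [hij]
      · have := hμ i j hij
        rw [Measure.map_smul, Measure.map_snd_prod, measure_univ, one_smul]
    simp_rw [Λ, Measure.map_finset_sum' measurable_snd.aemeasurable, this]
    rw [Finset.sum_comm]
    simp_rw [← Finset.sum_smul, hcol]
    exact sum_meas_smul_cond_fiber hG ν
  have hΛ : IsProbabilityMeasure Λ := ⟨by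
    rw [← Set.preimage_univ (f := Prod.fst), ← Measure.map_apply measurable_fst .univ, h1,
      measure_univ]⟩
  refine ⟨Λ, hΛ, h1, h2, fun c => ?_⟩
  have hint : ∀ i j, Integrable (fun z : X × Y => c (F z.1) (G z.2))
      (ENNReal.ofReal (π i j) • (μ[|F ⁻¹' {i}]).prod (ν[|G ⁻¹' {j}])) := fun i j => by
    refine Integrable.smul_measure ?_ ENNReal.ofReal_ne_top
    have hm : Measurable fun z : X × Y => (F z.1, G z.2) := by fun_prop
    exact (Integrable.of_finite (f := fun k : ι × κ => c k.1 k.2)).comp_measurable hm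
  rw [integral_finsetSum_measure fun i _ => integrable_finsetSum_measure.2 fun j _ => hint i j]
  refine Finset.sum_congr rfl fun i _ => ?_
  rw [integral_finsetSum_measure fun j _ => hint i j]
  refine Finset.sum_congr rfl fun j _ => ?_
  by_cases hij : π i j = 0
  · simp [hij]
  have := hμ i j hij
  have := hν i j hij
  have hae : (fun z : X × Y => c (F z.1) (G z.2))
      =ᵐ[(μ[|F ⁻¹' {i}]).prod (ν[|G ⁻¹' {j}])] fun _ => c i j := by
    filter_upwards [Measure.quasiMeasurePreserving_fst.ae (ae_cond_mem (μ := μ) (hFi i)),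
      Measure.quasiMeasurePreserving_snd.ae (ae_cond_mem (μ := ν) (hGj j))] with z hz1 hz2
    rw [show F z.1 = i from hz1, show G z.2 = j from hz2]
  rw [integral_smul_measure, integral_congr_ae hae, integral_const, probReal_univ, one_smul,
    ENNReal.toReal_ofReal (hπ i j), smul_eq_mul]

/-- Dual-feasible potentials on finitely many points are dominated by a 1-Lipschitz function. -/
theorem exists_lipschitzWith_of_add_le_dist {S ι : Type*} [PseudoMetricSpace S] [Fintype ι]
    [Nonempty ι] (e : ι → S) (φ ψ : ι → ℝ) (h : ∀ i j, φ i + ψ j ≤ dist (e i) (e j)) :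
    ∃ f : S → ℝ, LipschitzWith 1 f ∧ (∀ i, φ i ≤ f (e i)) ∧ ∀ j, ψ j ≤ -f (e j) := by
  refine ⟨fun x => Finset.univ.inf' Finset.univ_nonempty fun j => dist x (e j) - ψ j,
    LipschitzWith.of_le_add fun x y => ?_, fun i => ?_, fun j => ?_⟩
  · rw [← sub_le_iff_le_add]
    refine Finset.le_inf' _ _ fun j hj => ?_
    have := Finset.inf'_le (fun j => dist x (e j) - ψ j) hj
    linarith [dist_triangle x y (e j)]
  · exact Finset.le_inf' _ _ fun j _ => by linarith [h i j]
  · have := Finset.inf'_le (fun k => dist (e j) (e k) - ψ k) (Finset.mem_univ j)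
    rw [dist_self] at this
    linarith

theorem LipschitzWith.integrable_of_integrable_dist {S : Type*} [MeasurableSpace S]
    [PseudoMetricSpace S] [OpensMeasurableSpace S] {μ : Measure S} [IsFiniteMeasure μ] {f : S → ℝ}
    (hf : LipschitzWith 1 f) {x₀ : S} (h : Integrable (fun x => dist x x₀) μ) :
    Integrable f μ := by
  refine ((integrable_const |f x₀|).add h).mono' hf.continuous.measurable.aestronglyMeasurable
    (.of_forall fun x => ?_)
  have := hf.dist_le_mul x x₀
  rw [Real.dist_eq, NNReal.coe_one, one_mul] at this
  have h2 := abs_sub_abs_le_abs_sub (f x) (f x₀)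
  simp only [Real.norm_eq_abs, Pi.add_apply]
  linarith

section Lipschitz

variable {S : Type*} [MeasurableSpace S] [MetricSpace S] [BorelSpace S]
  [TopologicalSpace.SeparableSpace S]

theorem integrable_dist_of_marginals {Λ : Measure (S × S)} {x₀ : S}
    (h₁ : Integrable (fun x => dist x x₀) (Λ.map Prod.fst))
    (h₂ : Integrable (fun x => dist x x₀) (Λ.map Prod.snd)) :
    Integrable (fun z : S × S => dist z.1 z.2) Λ := by
  have : SecondCountableTopology S := UniformSpace.secondCountable_of_separable S
  refine ((h₁.comp_measurable measurable_fst).add (h₂.comp_measurable measurable_snd)).mono'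
    measurable_dist.aestronglyMeasurable (.of_forall fun z => ?_)
  rw [Real.norm_of_nonneg dist_nonneg]
  exact dist_triangle_right _ _ _

theorem abs_integral_sub_le_integral_dist {Λ : Measure (S × S)} [IsProbabilityMeasure Λ] {x₀ : S}
    (h₁ : Integrable (fun x => dist x x₀) (Λ.map Prod.fst))
    (h₂ : Integrable (fun x => dist x x₀) (Λ.map Prod.snd))
    {f : S → ℝ} (hf : LipschitzWith 1 f) :
    |∫ x, f x ∂Λ.map Prod.fst - ∫ x, f x ∂Λ.map Prod.snd| ≤ ∫ z, dist z.1 z.2 ∂Λ := by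
  have i1 : Integrable (fun z => f z.1) Λ :=
    (hf.integrable_of_integrable_dist h₁).comp_measurable measurable_fst
  have i2 : Integrable (fun z => f z.2) Λ :=
    (hf.integrable_of_integrable_dist h₂).comp_measurable measurable_snd
  have hm := hf.continuous.measurable.stronglyMeasurable
  rw [integral_map_of_stronglyMeasurable measurable_fst hm,
    integral_map_of_stronglyMeasurable measurable_snd hm, ← integral_sub i1 i2]
  refine abs_integral_le_integral_abs.trans
    (integral_mono (i1.sub i2).abs (integrable_dist_of_marginals h₁ h₂) fun z => ?_)
  simpa [Real.dist_eq] using hf.dist_le_mul z.1 z.2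

/-- Finite quantization: two measures with finite first moment admit a common finite-valued
measurable map close to the identity on average. -/
theorem exists_quantization {μ₁ μ₂ : Measure S} {x₀ : S}
    (h₁ : Integrable (fun x => dist x x₀) μ₁) (h₂ : Integrable (fun x => dist x x₀) μ₂)
    {ε : ℝ} (hε : 0 < ε) :
    ∃ (N : ℕ) (e : Fin (N + 1) → S) (F : S → Fin (N + 1)), Measurable F ∧
      Integrable (fun x => dist x (e (F x))) μ₁ ∧ Integrable (fun x => dist x (e (F x))) μ₂ ∧
      ∫ x, dist x (e (F x)) ∂μ₁ < ε ∧ ∫ x, dist x (e (F x)) ∂μ₂ < ε := by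
  have : SecondCountableTopology S := UniformSpace.secondCountable_of_separable S
  have : Nonempty S := ⟨x₀⟩
  let e : ℕ → S := fun k => Nat.casesOn k x₀ (TopologicalSpace.denseSeq S)
  have he : ∀ x, x ∈ closure (Set.range e) := fun x => by
    refine closure_mono ?_ (TopologicalSpace.denseRange_denseSeq S x)
    rintro _ ⟨k, rfl⟩
    exact ⟨k + 1, rfl⟩
  have hbound : ∀ N x, ‖dist x (SimpleFunc.nearestPt e N x)‖ ≤ dist x x₀ := fun N x => by
    rw [Real.norm_of_nonneg dist_nonneg, dist_comm, dist_comm x]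
    have := SimpleFunc.edist_nearestPt_le e x (Nat.zero_le N)
    rwa [edist_dist, edist_dist, ENNReal.ofReal_le_ofReal_iff dist_nonneg] at this
  have hmeas : ∀ N, Measurable fun x => dist x (SimpleFunc.nearestPt e N x) := fun N =>
    measurable_id.dist (SimpleFunc.nearestPt e N).measurable
  have hlim : ∀ x, Filter.Tendsto (fun N => dist x (SimpleFunc.nearestPt e N x)) Filter.atTop
      (nhds 0) := fun x => by
    have := (tendsto_const_nhds (x := x)).dist (SimpleFunc.tendsto_nearestPt (he x))
    rwa [dist_self] at this
  have htend : ∀ μ : Measure S, Integrable (fun x => dist x x₀) μ → Filter.Tendsto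
      (fun N => ∫ x, dist x (SimpleFunc.nearestPt e N x) ∂μ) Filter.atTop (nhds 0) := by
    intro μ h
    simpa using tendsto_integral_of_dominated_convergence (fun x => dist x x₀)
      (fun N => (hmeas N).aestronglyMeasurable) h (fun N => .of_forall (hbound N))
      (.of_forall hlim)
  obtain ⟨N, hN₁, hN₂⟩ := (((htend μ₁ h₁).eventually_lt_const hε).and
    ((htend μ₂ h₂).eventually_lt_const hε)).exists
  refine ⟨N, fun k => e k, fun x => ⟨SimpleFunc.nearestPtInd e N x,
    Nat.lt_succ_of_le (SimpleFunc.nearestPtInd_le e N x)⟩, ?_,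
    h₁.mono' (hmeas N).aestronglyMeasurable (.of_forall (hbound N)),
    h₂.mono' (hmeas N).aestronglyMeasurable (.of_forall (hbound N)), hN₁, hN₂⟩
  refine measurable_to_countable' fun k => ?_
  convert (SimpleFunc.nearestPtInd e N).measurableSet_fiber k.1 using 1
  ext x
  simp [Fin.ext_iff]

theorem exists_coupling_integral_dist_le {μ₁ μ₂ : Measure S} [IsProbabilityMeasure μ₁]
    [IsProbabilityMeasure μ₂] {x₀ : S}
    (h₁ : Integrable (fun x => dist x x₀) μ₁) (h₂ : Integrable (fun x => dist x x₀) μ₂)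
    {K : ℝ} (hK : ∀ f : S → ℝ, LipschitzWith 1 f → ∫ x, f x ∂μ₁ - ∫ x, f x ∂μ₂ ≤ K)
    {ε : ℝ} (hε : 0 < ε) :
    ∃ Λ : Measure (S × S), IsProbabilityMeasure Λ ∧ Λ.map Prod.fst = μ₁ ∧ Λ.map Prod.snd = μ₂ ∧
      ∫ z, dist z.1 z.2 ∂Λ ≤ K + 4 * ε := by
  have : SecondCountableTopology S := UniformSpace.secondCountable_of_separable S
  obtain ⟨N, e, F, hF, i₁, i₂, hε₁, hε₂⟩ := exists_quantization h₁ h₂ hε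
  have hsum : ∀ (μ : Measure S) [IsProbabilityMeasure μ] (g : Fin (N + 1) → ℝ),
      ∑ i, μ.real (F ⁻¹' {i}) * g i = ∫ x, g (F x) ∂μ := by
    intro μ _ g
    have := Measure.isProbabilityMeasure_map (μ := μ) hF.aemeasurable
    rw [← integral_map_of_stronglyMeasurable hF (measurable_of_finite g).stronglyMeasurable,
      integral_fintype .of_finite]
    simp [map_measureReal_apply hF (measurableSet_singleton _)]
  have hsimplex : ∀ (μ : Measure S) [IsProbabilityMeasure μ],
      (fun i => μ.real (F ⁻¹' {i})) ∈ stdSimplex ℝ (Fin (N + 1)) := fun μ _ =>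
    ⟨fun i => measureReal_nonneg, by simpa using hsum μ fun _ => 1⟩
  have hgF : ∀ (μ : Measure S) [IsProbabilityMeasure μ] (g : Fin (N + 1) → ℝ),
      Integrable (fun x => g (F x)) μ := fun μ _ g =>
    (Integrable.of_finite (f := g)).comp_measurable hF
  obtain ⟨π, hπ, hπ₁, hπ₂, hπC⟩ := exists_plan_cost_le_of_dual_le (hsimplex μ₁) (hsimplex μ₂)
    (fun i j => dist (e i) (e j)) (K + 2 * ε) fun φ ψ hφψ => by
      obtain ⟨f, hf, hφ, hψ⟩ := exists_lipschitzWith_of_add_le_dist e φ ψ hφψ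
      have hf₁ := hf.integrable_of_integrable_dist h₁
      have hf₂ := hf.integrable_of_integrable_dist h₂
      have hle : ∀ x y, f x - f y ≤ dist x y := fun x y => by
        simpa [Real.dist_eq] using (le_abs_self _).trans (hf.dist_le_mul x y)
      have e₁ : ∫ x, φ (F x) ∂μ₁ ≤ ∫ x, f x + dist x (e (F x)) ∂μ₁ :=
        integral_mono (hgF μ₁ φ) (hf₁.add i₁) fun x => by
          have := hle (e (F x)) x
          rw [dist_comm] at this
          have := hφ (F x)
          simp only
          linarith
      have e₂ : ∫ x, ψ (F x) ∂μ₂ ≤ ∫ x, dist x (e (F x)) - f x ∂μ₂ :=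
        integral_mono (hgF μ₂ ψ) (i₂.sub hf₂) fun x => by
          have := hle x (e (F x))
          have := hψ (F x)
          simp only
          linarith
      rw [integral_add hf₁ i₁] at e₁
      rw [integral_sub i₂ hf₂] at e₂
      rw [hsum, hsum]
      linarith [hK f hf]
  obtain ⟨Λ, hΛ, hΛ₁, hΛ₂, hΛc⟩ := exists_coupling_of_plan μ₁ μ₂ hF hF π hπ hπ₁ hπ₂
  refine ⟨Λ, hΛ, hΛ₁, hΛ₂, ?_⟩
  have hm : Measurable fun x => dist x (e (F x)) :=
    measurable_id.dist ((measurable_of_finite e).comp hF)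
  have j₁ : Integrable (fun z : S × S => dist z.1 (e (F z.1))) Λ :=
    Integrable.comp_measurable (f := Prod.fst) (hΛ₁ ▸ i₁) measurable_fst
  have j₂ : Integrable (fun z : S × S => dist z.2 (e (F z.2))) Λ :=
    Integrable.comp_measurable (f := Prod.snd) (hΛ₂ ▸ i₂) measurable_snd
  have jF : Measurable fun z : S × S => (F z.1, F z.2) := by fun_prop
  have j₃ : Integrable (fun z : S × S => dist (e (F z.1)) (e (F z.2))) Λ :=
    (Integrable.of_finite (f := fun k : Fin (N + 1) × Fin (N + 1) =>
      dist (e k.1) (e k.2))).comp_measurable jF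
  have c₁ : ∫ z, dist z.1 (e (F z.1)) ∂Λ = ∫ x, dist x (e (F x)) ∂μ₁ := by
    rw [← hΛ₁, integral_map_of_stronglyMeasurable measurable_fst hm.stronglyMeasurable]
  have c₂ : ∫ z, dist z.2 (e (F z.2)) ∂Λ = ∫ x, dist x (e (F x)) ∂μ₂ := by
    rw [← hΛ₂, integral_map_of_stronglyMeasurable measurable_snd hm.stronglyMeasurable]
  have hle : ∫ z, dist z.1 z.2 ∂Λ ≤
      ∫ z, dist z.1 (e (F z.1)) + dist z.2 (e (F z.2)) + dist (e (F z.1)) (e (F z.2)) ∂Λ :=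
    integral_mono (integrable_dist_of_marginals (hΛ₁ ▸ h₁) (hΛ₂ ▸ h₂)) ((j₁.add j₂).add j₃)
      fun z => by
        have := dist_triangle4 z.1 (e (F z.1)) (e (F z.2)) z.2
        rw [dist_comm (e (F z.2))] at this
        simp only
        linarith
  rw [integral_add (f := fun z : S × S => dist z.1 (e (F z.1)) + dist z.2 (e (F z.2)))
    (j₁.add j₂) j₃, integral_add j₁ j₂, c₁, c₂,
    hΛc fun i j => dist (e i) (e j)] at hle
  linarith

end Lipschitz

/-- Kantorovich–Rubinstein duality on a Polish space: the L¹-Wasserstein distance between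
two probability measures with finite first moment equals the supremum over 1-Lipschitz
functions of the difference of their integrals. -/
theorem stmt1 {S : Type*} [MeasurableSpace S] [MetricSpace S] [BorelSpace S]
    [TopologicalSpace.SeparableSpace S] [CompleteSpace S]
    (μ₁ μ₂ : Measure S) [IsProbabilityMeasure μ₁] [IsProbabilityMeasure μ₂]
    (h₁ : ∀ x₀ : S, Integrable (fun x => dist x x₀) μ₁)
    (h₂ : ∀ x₀ : S, Integrable (fun x => dist x x₀) μ₂) :
    wassDist μ₁ μ₂ =
      ⨆ f : {f : S → ℝ // LipschitzWith 1 f}, |(∫ x, f.1 x ∂μ₁) - ∫ x, f.1 x ∂μ₂| := by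
  obtain ⟨x₀⟩ : Nonempty S := nonempty_of_isProbabilityMeasure μ₁
  have hweak : ∀ Λ : Measure (S × S), IsProbabilityMeasure Λ → Λ.map Prod.fst = μ₁ →
      Λ.map Prod.snd = μ₂ → ∀ f : {f : S → ℝ // LipschitzWith 1 f},
      |(∫ x, f.1 x ∂μ₁) - ∫ x, f.1 x ∂μ₂| ≤ ∫ z, dist z.1 z.2 ∂Λ := by
    rintro Λ hΛ rfl rfl f
    exact abs_integral_sub_le_integral_dist (h₁ x₀) (h₂ x₀) f.2
  have hprod₁ : (μ₁.prod μ₂).map Prod.fst = μ₁ := by simp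
  have hprod₂ : (μ₁.prod μ₂).map Prod.snd = μ₂ := by simp
  have : Nonempty {f : S → ℝ // LipschitzWith 1 f} := ⟨⟨0, LipschitzWith.const' 0⟩⟩
  refine le_antisymm (le_of_forall_pos_le_add fun ε hε => ?_) (ciSup_le fun f => ?_)
  · have hbdd : BddAbove (Set.range fun f : {f : S → ℝ // LipschitzWith 1 f} =>
        |(∫ x, f.1 x ∂μ₁) - ∫ x, f.1 x ∂μ₂|) := by
      refine ⟨∫ z, dist z.1 z.2 ∂μ₁.prod μ₂, ?_⟩
      rintro _ ⟨f, rfl⟩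
      exact hweak _ inferInstance hprod₁ hprod₂ f
    obtain ⟨Λ, hΛ, hΛ₁, hΛ₂, hle⟩ := exists_coupling_integral_dist_le (h₁ x₀) (h₂ x₀)
      (fun f hf => (le_abs_self _).trans (le_ciSup hbdd ⟨f, hf⟩)) (div_pos hε four_pos)
    rw [mul_div_cancel₀ _ four_ne_zero] at hle
    refine le_trans (csInf_le ⟨0, ?_⟩ ⟨Λ, hΛ, hΛ₁, hΛ₂, rfl⟩) hle
    rintro _ ⟨Λ', -, -, -, rfl⟩
    exact integral_nonneg fun _ => dist_nonneg
  · refine le_csInf ⟨_, μ₁.prod μ₂, inferInstance, hprod₁, hprod₂, rfl⟩ ?_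
    rintro _ ⟨Λ, hΛ, hΛ₁, hΛ₂, rfl⟩
    exact hweak Λ hΛ hΛ₁ hΛ₂ f
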